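/- arXiv:2104.14450 — 6 statements merged into one kernel-verified Lean document; each statement's English description precedes it below -/
import Mathlib

section
/- Let n ≥ 1, λ > 0, δ ∈ (0,1). Let A be an n×n real symmetric matrix, b ∈ ℝⁿ and c ∈ ℝ with |A|² + |b|²/(2λ) + c²/λ² > 0, satisfying the Cordes condition with constants λ, δ, and set γ := (tr(A) + c/λ)/(|A|² + |b|²/(2λ) + c²/λ²). Then for every n×n real symmetric matrix M, every p ∈ ℝⁿ and every u ∈ ℝ one has |γ·(−A:M − b·p + c·u) + tr(M) − λu| ≤ √(1−δ) · √(|M|² + 2λ|p|² + λ²u²). -/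
open Matrix BigOperators

/-- Frobenius inner product `A : M = tr(Aᵀ M)` of two real `n × n` matrices. -/
noncomputable def fip {n : ℕ} (A M : Matrix (Fin n) (Fin n) ℝ) : ℝ := (Aᵀ * M).trace

theorem fip_eq {n : ℕ} (A M : Matrix (Fin n) (Fin n) ℝ) :
    fip A M = ∑ i, ∑ j, A j i * M j i := by
  simp [fip, Matrix.trace, Matrix.mul_apply]

theorem fip_self_nonneg {n : ℕ} (A : Matrix (Fin n) (Fin n) ℝ) : 0 ≤ fip A A := by
  rw [fip_eq]
  exact Finset.sum_nonneg fun i _ => Finset.sum_nonneg fun j _ => mul_self_nonneg _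

theorem fip_comm {n : ℕ} (A M : Matrix (Fin n) (Fin n) ℝ) : fip A M = fip M A := by
  simp only [fip_eq, mul_comm]

theorem fip_expand {n : ℕ} (A M : Matrix (Fin n) (Fin n) ℝ) (g t : ℝ) :
    fip (1 - g • A + t • M) (1 - g • A + t • M)
      = n + g ^ 2 * fip A A + t ^ 2 * fip M M - 2 * g * A.trace + 2 * t * M.trace
        - 2 * g * t * fip A M := by
  have h := fip_comm A M
  unfold fip at *
  simp only [transpose_add, transpose_sub, transpose_smul, transpose_one, add_mul, mul_add,
    sub_mul, mul_sub, Matrix.trace_add, Matrix.trace_sub, smul_mul_assoc, mul_smul_comm,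
    Matrix.trace_smul, one_mul, mul_one, Matrix.trace_transpose, Matrix.trace_one,
    Fintype.card_fin, smul_eq_mul]
  rw [← h]
  ring

theorem vec_expand {n : ℕ} (b p : Fin n → ℝ) (g s : ℝ) :
    0 ≤ g ^ 2 * (∑ i, b i ^ 2) - 2 * g * s * (∑ i, b i * p i) + s ^ 2 * ∑ i, p i ^ 2 := by
  have : 0 ≤ ∑ i, (g * b i - s * p i) ^ 2 := Finset.sum_nonneg fun i _ => sq_nonneg _
  convert this using 1
  simp only [Finset.mul_sum, ← Finset.sum_sub_distrib, ← Finset.sum_add_distrib]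
  exact Finset.sum_congr rfl fun i _ => by ring

/-- pointwise consequence of the Cordes condition. -/
theorem stmt1 {n : ℕ} (hn : 1 ≤ n) (lam δ : ℝ) (hlam : 0 < lam)
    (hδ : δ ∈ Set.Ioo (0 : ℝ) 1)
    (A : Matrix (Fin n) (Fin n) ℝ) (hA : A.IsSymm) (b : Fin n → ℝ) (c : ℝ)
    (hDpos : 0 < fip A A + (∑ i, b i ^ 2) / (2 * lam) + c ^ 2 / lam ^ 2)
    (hCordes : fip A A + (∑ i, b i ^ 2) / (2 * lam) + c ^ 2 / lam ^ 2
      ≤ (1 / ((n : ℝ) + δ)) * (A.trace + c / lam) ^ 2)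
    (γ : ℝ)
    (hγ : γ = (A.trace + c / lam) / (fip A A + (∑ i, b i ^ 2) / (2 * lam) + c ^ 2 / lam ^ 2)) :
    ∀ (M : Matrix (Fin n) (Fin n) ℝ), M.IsSymm → ∀ (p : Fin n → ℝ) (u : ℝ),
      |γ * (-(fip A M) - (∑ i, b i * p i) + c * u) + M.trace - lam * u|
        ≤ Real.sqrt (1 - δ)
          * Real.sqrt (fip M M + 2 * lam * (∑ i, p i ^ 2) + lam ^ 2 * u ^ 2) := by
  intro M _ p u
  obtain ⟨hδ0, hδ1⟩ := hδ
  set D := fip A A + (∑ i, b i ^ 2) / (2 * lam) + c ^ 2 / lam ^ 2 with hD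
  set T := A.trace + c / lam with hT
  set N := fip M M + 2 * lam * (∑ i, p i ^ 2) + lam ^ 2 * u ^ 2 with hN
  set E := γ * (-(fip A M) - (∑ i, b i * p i) + c * u) + M.trace - lam * u with hE
  have hNn : 0 ≤ N := by
    have h1 := fip_self_nonneg M
    have h2 : 0 ≤ ∑ i, p i ^ 2 := Finset.sum_nonneg fun i _ => sq_nonneg _
    positivity
  have hnd : 0 < (n : ℝ) + δ := by positivity
  have hS : (n : ℝ) + 1 - 2 * γ * T + γ ^ 2 * D ≤ 1 - δ := by
    have e : (n : ℝ) + 1 - 2 * γ * T + γ ^ 2 * D = n + 1 - T ^ 2 / D := by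
      rw [hγ]; field_simp; ring
    rw [e]
    have : (n : ℝ) + δ ≤ T ^ 2 / D := by
      rw [le_div_iff₀ hDpos]
      rw [one_div, inv_mul_eq_div, le_div_iff₀ hnd] at hCordes
      linarith
    linarith
  have key : ∀ t : ℝ, 0 ≤ N * (t * t) + (2 * E) * t + (1 - δ) := by
    intro t
    have h1 := fip_self_nonneg (1 - γ • A + t • M)
    rw [fip_expand] at h1
    have h2 := div_nonneg (vec_expand b p γ (2 * lam * t)) (by positivity : 0 ≤ 2 * lam)
    have h3 := sq_nonneg (γ * c / lam - 1 + t * (lam * u))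
    have e : N * (t * t) + (2 * E) * t + ((n : ℝ) + 1 - 2 * γ * T + γ ^ 2 * D)
        = (n + γ ^ 2 * fip A A + t ^ 2 * fip M M - 2 * γ * A.trace + 2 * t * M.trace
        - 2 * γ * t * fip A M) + (γ ^ 2 * (∑ i, b i ^ 2) - 2 * γ * (2 * lam * t) * (∑ i, b i * p i)
          + (2 * lam * t) ^ 2 * ∑ i, p i ^ 2) / (2 * lam)
        + (γ * c / lam - 1 + t * (lam * u)) ^ 2 := by
      rw [hN, hE, hT, hD]
      clear_value D T N E
      field_simp
      ring
    linarith
  have hd := discrim_le_zero key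
  unfold discrim at hd
  rw [← Real.sqrt_mul (by linarith)]
  apply Real.abs_le_sqrt
  nlinarith
end

section
/- Let 𝒜 and ℬ be nonempty compact metric spaces, let g : 𝒜×ℬ → ℝ be continuous, and let γ : 𝒜×ℬ → ℝ be continuous with γ(α,β) ≥ γ₀ for all (α,β), for some constant γ₀ > 0. Then inf_{α∈𝒜} sup_{β∈ℬ} [ γ(α,β)·g(α,β) ] = 0 if and only if inf_{α∈𝒜} sup_{β∈ℬ} g(α,β) = 0. -/
open BigOperators

theorem infsup_char {A B : Type*} [MetricSpace A] [CompactSpace A] [Nonempty A]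
    [MetricSpace B] [CompactSpace B] [Nonempty B]
    (f : A × B → ℝ) (hf : Continuous f) :
    (⨅ α : A, ⨆ β : B, f (α, β)) = 0 ↔
      (∀ α, ∃ β, 0 ≤ f (α, β)) ∧ ∀ ε > 0, ∃ α, ∀ β, f (α, β) ≤ ε := by
  have hs : ∀ α, BddAbove (Set.range fun β => f (α, β)) := fun α =>
    (isCompact_range (by fun_prop)).bddAbove
  obtain ⟨m, hm⟩ := (isCompact_range hf).bddBelow
  have hb : BddBelow (Set.range fun α => ⨆ β, f (α, β)) := by
    refine ⟨m, ?_⟩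
    rintro _ ⟨α, rfl⟩
    obtain ⟨b⟩ := ‹Nonempty B›
    exact (hm ⟨(α, b), rfl⟩).trans (le_ciSup (hs α) b)
  constructor
  · intro h
    refine ⟨fun α => ?_, fun ε hε => ?_⟩
    · have hc : Continuous fun β => f (α, β) := by fun_prop
      obtain ⟨b, -, hbm⟩ := isCompact_univ.exists_isMaxOn Set.univ_nonempty hc.continuousOn
      refine ⟨b, ?_⟩
      rw [← h]
      exact (ciInf_le hb α).trans (ciSup_le fun β => hbm (Set.mem_univ β))
    · obtain ⟨α, hα⟩ := exists_lt_of_ciInf_lt (h.trans_lt hε)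
      exact ⟨α, fun β => (le_ciSup (hs α) β).trans hα.le⟩
  · rintro ⟨h1, h2⟩
    apply le_antisymm
    · refine le_of_forall_pos_le_add fun ε hε => ?_
      obtain ⟨α, hα⟩ := h2 ε hε
      rw [zero_add]
      exact (ciInf_le hb α).trans (ciSup_le hα)
    · refine le_ciInf fun α => ?_
      obtain ⟨β, hβ⟩ := h1 α
      exact hβ.trans (le_ciSup (hs α) β)

/-- equivalence of the renormalized and original inf-sup equations. -/
theorem stmt5 {𝒜 ℬ : Type*} [MetricSpace 𝒜] [CompactSpace 𝒜] [Nonempty 𝒜]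
    [MetricSpace ℬ] [CompactSpace ℬ] [Nonempty ℬ]
    (g γ : 𝒜 × ℬ → ℝ) (hg : Continuous g) (hγ : Continuous γ)
    (γ₀ : ℝ) (hγ₀ : 0 < γ₀) (hγlb : ∀ q, γ₀ ≤ γ q) :
    (⨅ α : 𝒜, ⨆ β : ℬ, γ (α, β) * g (α, β)) = 0
      ↔ (⨅ α : 𝒜, ⨆ β : ℬ, g (α, β)) = 0 := by
  have hp : ∀ q, 0 < γ q := fun q => hγ₀.trans_le (hγlb q)
  obtain ⟨M, hM⟩ := (isCompact_range hγ).bddAbove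
  have hM' : ∀ q, γ q ≤ M := fun q => hM ⟨q, rfl⟩
  have hMp : 0 < M := by
    obtain ⟨q⟩ : Nonempty (𝒜 × ℬ) := inferInstance
    exact (hp q).trans_le (hM' q)
  rw [infsup_char g hg, infsup_char (fun q => γ q * g q) (hγ.mul hg)]
  refine and_congr ?_ ⟨fun h ε hε => ?_, fun h ε hε => ?_⟩
  · exact forall_congr' fun α => exists_congr fun β => mul_nonneg_iff_of_pos_left (hp _)
  · obtain ⟨α, hα⟩ := h (γ₀ * ε) (by positivity)
    refine ⟨α, fun β => ?_⟩
    by_contra! hc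
    have h1 := hα β
    have h2 := hγlb (α, β)
    nlinarith
  · obtain ⟨α, hα⟩ := h (ε / M) (by positivity)
    refine ⟨α, fun β => ?_⟩
    calc γ (α, β) * g (α, β) ≤ γ (α, β) * (ε / M) :=
          mul_le_mul_of_nonneg_left (hα β) (hp _).le
      _ ≤ M * (ε / M) := mul_le_mul_of_nonneg_right (hM' _) (by positivity)
      _ = ε := by field_simp
end

section
/- Let n ≥ 1 and let w : ℝⁿ → ℝⁿ be smooth (C^∞) and ℤⁿ-periodic. Then ∫_Y (div w)² ≤ ∫_Y |Dw|², where Dw denotes the Jacobian matrix of w, |Dw| its Frobenius norm, and div w := tr(Dw). -/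
open MeasureTheory BigOperators

/-- Partial derivative `∂v/∂xᵢ` of a function on `ℝⁿ = Fin n → ℝ`. -/
noncomputable def pd {n : ℕ} (i : Fin n) (v : (Fin n → ℝ) → ℝ) (x : Fin n → ℝ) : ℝ :=
  fderiv ℝ v x (Pi.single i 1)

/-- `ℤⁿ`-periodicity of a vector field on `ℝⁿ`. -/
def ZPeriodicV {n : ℕ} (w : (Fin n → ℝ) → Fin n → ℝ) : Prop :=
  ∀ (x : Fin n → ℝ) (z : Fin n → ℤ), w (x + fun i => (z i : ℝ)) = w x


theorem aux_pd_contDiff {n : ℕ} (i : Fin n) {v : (Fin n → ℝ) → ℝ}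
    (hv : ContDiff ℝ (⊤ : ℕ∞) v) : ContDiff ℝ (⊤ : ℕ∞) (pd i v) := by
  have h : ContDiff ℝ (⊤ : ℕ∞) (fderiv ℝ v) := hv.fderiv_right (by simp)
  exact h.clm_apply contDiff_const

theorem aux_pd_per {n : ℕ} (i : Fin n) {v : (Fin n → ℝ) → ℝ}
    (hp : ∀ (x : Fin n → ℝ) (z : Fin n → ℤ), v (x + fun i => (z i : ℝ)) = v x)
    (x : Fin n → ℝ) (z : Fin n → ℤ) : pd i v (x + fun i => (z i : ℝ)) = pd i v x := by
  unfold pd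
  rw [← fderiv_comp_add_right]
  simp only [hp]

theorem aux_pd_mul {n : ℕ} (i : Fin n) {u v : (Fin n → ℝ) → ℝ}
    (hu : ContDiff ℝ (⊤ : ℕ∞) u) (hv : ContDiff ℝ (⊤ : ℕ∞) v) (x : Fin n → ℝ) :
    pd i (fun y => u y * v y) x = u x * pd i v x + v x * pd i u x := by
  unfold pd
  rw [fderiv_fun_mul (hu.differentiable (by simp) x) (hv.differentiable (by simp) x)]
  simp

theorem aux_pd_comm {n : ℕ} (i j : Fin n) {v : (Fin n → ℝ) → ℝ}
    (hv : ContDiff ℝ (⊤ : ℕ∞) v) (x : Fin n → ℝ) :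
    pd i (pd j v) x = pd j (pd i v) x := by
  have h : ContDiff ℝ (⊤ : ℕ∞) (fderiv ℝ v) := hv.fderiv_right (by simp)
  have hd := h.differentiable (by simp) x
  have key : ∀ a b : Fin n, pd a (pd b v) x
      = fderiv ℝ (fderiv ℝ v) x (Pi.single a 1) (Pi.single b 1) := by
    intro a b
    change fderiv ℝ (fun y => fderiv ℝ v y (Pi.single b 1)) x (Pi.single a 1) = _
    rw [fderiv_clm_apply hd (differentiableAt_const _)]
    simp
  rw [key, key]
  have hs : IsSymmSndFDerivAt ℝ v x :=
    hv.contDiffAt.isSymmSndFDerivAt (by simp only [minSmoothness_of_isRCLikeNormedField]; exact WithTop.coe_le_coe.2 (le_top : (2 : ℕ∞) ≤ ⊤))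
  exact hs _ _

theorem aux_int {n : ℕ} {v : (Fin n → ℝ) → ℝ} (hv : ContDiff ℝ (⊤ : ℕ∞) v) :
    IntegrableOn v (Set.Icc (0 : Fin n → ℝ) 1) :=
  hv.continuous.continuousOn.integrableOn_compact isCompact_Icc

theorem aux_zero {n : ℕ} (i : Fin n) {v : (Fin n → ℝ) → ℝ}
    (hv : ContDiff ℝ (⊤ : ℕ∞) v)
    (hp : ∀ (x : Fin n → ℝ) (z : Fin n → ℤ), v (x + fun i => (z i : ℝ)) = v x) :
    ∫ x in Set.Icc (0 : Fin n → ℝ) 1, pd i v x = 0 := by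
  obtain _ | m := n
  · exact i.elim0
  have hsum : ∀ x, ∑ k, (if k = i then fderiv ℝ v x else 0) (Pi.single k 1) = pd i v x := by
    intro x
    rw [Finset.sum_eq_single i]
    · simp [pd]
    · intro b _ hb
      simp [hb]
    · simp
  have h := integral_divergence_of_hasFDerivAt_off_countable' (0 : Fin (m+1) → ℝ) 1
    zero_le_one (fun k x => if k = i then v x else 0)
    (fun k x => if k = i then fderiv ℝ v x else 0) ∅ Set.countable_empty
    (by
      intro k
      by_cases hk : k = i
      · simpa [hk] using hv.continuous.continuousOn
      · simpa [hk] using continuousOn_const)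
    (by
      intro x _ k
      by_cases hk : k = i
      · simpa [hk] using (hv.differentiable (by simp) x).hasFDerivAt
      · simpa [hk] using hasFDerivAt_const (0:ℝ) x)
    (by
      simp only [hsum]
      exact aux_int (aux_pd_contDiff i hv))
  simp only [hsum] at h
  rw [h]
  apply Finset.sum_eq_zero
  intro k _
  rw [sub_eq_zero]
  congr 1
  funext x
  have hx : v (k.insertNth ((1 : Fin (m+1) → ℝ) k) x)
      = v (k.insertNth ((0 : Fin (m+1) → ℝ) k) x) := by
    rw [← hp (k.insertNth ((0 : Fin (m+1) → ℝ) k) x) (Pi.single k 1)]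
    congr 1
    funext l
    refine Fin.succAboveCases k ?_ ?_ l
    · simp
    · intro l
      simp
  simp only [hx]

/-- `∫_Y (div w)² ≤ ∫_Y |Dw|²` for smooth `ℤⁿ`-periodic vector fields. -/
theorem stmt8 {n : ℕ} (hn : 1 ≤ n) (w : (Fin n → ℝ) → Fin n → ℝ)
    (hw : ContDiff ℝ (⊤ : ℕ∞) w) (hper : ZPeriodicV w) :
    ∫ x in Set.Icc (0 : Fin n → ℝ) 1, (∑ i, pd i (fun y => w y i) x) ^ 2
      ≤ ∫ x in Set.Icc (0 : Fin n → ℝ) 1, ∑ i, ∑ j, (pd j (fun y => w y i) x) ^ 2 := by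
  have hc : ∀ i, ContDiff ℝ (⊤ : ℕ∞) (fun y => w y i) := fun i => contDiff_pi.1 hw i
  have hp : ∀ i, ∀ (x : Fin n → ℝ) (z : Fin n → ℤ),
      (fun y => w y i) (x + fun i => (z i : ℝ)) = (fun y => w y i) x :=
    fun i x z => congrFun (hper x z) i
  have hd : ∀ j i, ContDiff ℝ (⊤ : ℕ∞) (pd j (fun y => w y i)) :=
    fun j i => aux_pd_contDiff j (hc i)
  -- null Lagrangian
  have hnull : ∀ i j, ∫ x in Set.Icc (0 : Fin n → ℝ) 1,
      (pd i (fun y => w y i) x * pd j (fun y => w y j) x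
        - pd j (fun y => w y i) x * pd i (fun y => w y j) x) = 0 := by
    intro i j
    have hA : ContDiff ℝ (⊤ : ℕ∞) (fun y => w y i * pd j (fun y => w y j) y) :=
      (hc i).mul (hd j j)
    have hB : ContDiff ℝ (⊤ : ℕ∞) (fun y => w y i * pd i (fun y => w y j) y) :=
      (hc i).mul (hd i j)
    have e : ∀ x, pd i (fun y => w y i) x * pd j (fun y => w y j) x
        - pd j (fun y => w y i) x * pd i (fun y => w y j) x
        = pd i (fun y => w y i * pd j (fun y => w y j) y) x
          - pd j (fun y => w y i * pd i (fun y => w y j) y) x := by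
      intro x
      rw [aux_pd_mul i (hc i) (hd j j), aux_pd_mul j (hc i) (hd i j),
        aux_pd_comm i j (hc j)]
      ring
    simp only [e]
    rw [integral_sub (aux_int (aux_pd_contDiff i hA)) (aux_int (aux_pd_contDiff j hB)),
      aux_zero i hA, aux_zero j hB, sub_zero]
    · intro x z
      have h1 := hp i x z
      have h2 := aux_pd_per i (v := fun y => w y j) (hp j) x z
      simp only at h1
      rw [h1, h2]
    · intro x z
      have h1 := hp i x z
      have h2 := aux_pd_per j (v := fun y => w y j) (hp j) x z
      simp only at h1
      rw [h1, h2]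
  have hN : ∀ i j, ContDiff ℝ (⊤ : ℕ∞) (fun x => pd i (fun y => w y i) x * pd j (fun y => w y j) x
        - pd j (fun y => w y i) x * pd i (fun y => w y j) x) :=
    fun i j => ((hd i i).mul (hd j j)).sub ((hd j i).mul (hd i j))
  have hsum : ∫ x in Set.Icc (0 : Fin n → ℝ) 1, ∑ i, ∑ j,
      (pd i (fun y => w y i) x * pd j (fun y => w y j) x
        - pd j (fun y => w y i) x * pd i (fun y => w y j) x) = 0 := by
    rw [integral_finsetSum _ fun i _ => aux_int (ContDiff.sum fun j _ => hN i j)]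
    refine Finset.sum_eq_zero fun i _ => ?_
    rw [integral_finsetSum _ fun j _ => aux_int (hN i j)]
    exact Finset.sum_eq_zero fun j _ => hnull i j
  have hL : ContDiff ℝ (⊤ : ℕ∞) (fun x => (∑ i, pd i (fun y => w y i) x) ^ 2) :=
    (ContDiff.sum fun i _ => hd i i).pow 2
  have hR : ContDiff ℝ (⊤ : ℕ∞) (fun x => ∑ i, ∑ j, (pd j (fun y => w y i) x) ^ 2) :=
    ContDiff.sum fun i _ => ContDiff.sum fun j _ => (hd j i).pow 2
  have hNN : ContDiff ℝ (⊤ : ℕ∞) (fun x => ∑ i, ∑ j,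
      (pd i (fun y => w y i) x * pd j (fun y => w y j) x
        - pd j (fun y => w y i) x * pd i (fun y => w y j) x)) :=
    ContDiff.sum fun i _ => ContDiff.sum fun j _ => hN i j
  rw [← sub_zero (∫ x in Set.Icc (0 : Fin n → ℝ) 1, (∑ i, pd i (fun y => w y i) x) ^ 2),
    ← hsum, ← integral_sub (aux_int hL) (aux_int hNN)]
  refine integral_mono ((aux_int hL).sub (aux_int hNN)) (aux_int hR) fun x => ?_
  have key : ∀ a : Fin n → Fin n → ℝ, (∑ i, a i i) ^ 2
      - ∑ i, ∑ j, (a i i * a j j - a i j * a j i) ≤ ∑ i, ∑ j, a i j ^ 2 := by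
    intro a
    have h1 : (∑ i, a i i) ^ 2 = ∑ i, ∑ j, a i i * a j j := by
      rw [sq, Finset.sum_mul_sum]
    have h2 : ∑ i, ∑ j, a i j ^ 2 = ∑ i, ∑ j, a j i ^ 2 := Finset.sum_comm
    have h3 : 2 * ∑ i, ∑ j, a i j * a j i ≤ ∑ i, ∑ j, a i j ^ 2 + ∑ i, ∑ j, a j i ^ 2 := by
      simp only [Finset.mul_sum, ← Finset.sum_add_distrib]
      refine Finset.sum_le_sum fun i _ => Finset.sum_le_sum fun j _ => ?_
      nlinarith [sq_nonneg (a i j - a j i)]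
    simp only [Finset.sum_sub_distrib]
    linarith
  exact key fun i j => pd j (fun y => w y i) x
end

section
/- Let V be a finite-dimensional real inner product space and let a : V×V → ℝ be a map that is linear in its second argument and satisfies: (Lipschitz continuity) there is C_L > 0 with |a(w,v) − a(w',v)| ≤ C_L‖w−w'‖‖v‖ for all w, w', v ∈ V; and (strong monotonicity) there is C_M > 0 with ‖w−w'‖² ≤ C_M·( a(w, w−w') − a(w', w−w') ) for all w, w' ∈ V. Then there exists a unique u ∈ V such that a(u,v) = 0 for all v ∈ V. -/
/-- Browder–Minty existence and uniqueness for a Lipschitz, strongly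
monotone semilinear form on a finite-dimensional real inner product space. -/
theorem stmt14 {V : Type*} [NormedAddCommGroup V] [InnerProductSpace ℝ V]
    [FiniteDimensional ℝ V]
    (a : V → V → ℝ) (hlin : ∀ w : V, IsLinearMap ℝ (a w))
    (CL : ℝ) (hCL : 0 < CL)
    (hLip : ∀ w w' v : V, |a w v - a w' v| ≤ CL * ‖w - w'‖ * ‖v‖)
    (CM : ℝ) (hCM : 0 < CM)
    (hMono : ∀ w w' : V, ‖w - w'‖ ^ 2 ≤ CM * (a w (w - w') - a w' (w - w'))) :
    ∃! u : V, ∀ v : V, a u v = 0 := by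
  have hA : ∀ w, ∃ z : V, ∀ v, inner ℝ z v = a w v := by
    intro w
    refine ⟨(InnerProductSpace.toDual ℝ V).symm
      (LinearMap.toContinuousLinearMap (IsLinearMap.mk' (a w) (hlin w))), fun v => ?_⟩
    rw [InnerProductSpace.toDual_symm_apply]
    rfl
  choose A hA using hA
  have hLA : ∀ w w', ‖A w - A w'‖ ≤ CL * ‖w - w'‖ := by
    intro w w'
    have h := hLip w w' (A w - A w')
    rw [← hA, ← hA, ← inner_sub_left, real_inner_self_eq_norm_sq, abs_of_nonneg (sq_nonneg _)] at h
    by_contra! hc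
    have h0 : 0 ≤ CL * ‖w - w'‖ := by positivity
    nlinarith
  have hMA : ∀ w w', ‖w - w'‖ ^ 2 ≤ CM * inner ℝ (w - w') (A w - A w') := by
    intro w w'
    have h := hMono w w'
    rwa [← hA, ← hA, ← inner_sub_left, real_inner_comm] at h
  obtain ⟨t, ht, q, hq0, hq1, hq⟩ : ∃ t : ℝ, 0 < t ∧ ∃ q : ℝ, 0 ≤ q ∧ q < 1 ∧
      1 - 2 * t / CM + t ^ 2 * CL ^ 2 ≤ q := by
    refine ⟨1 / (CM * CL ^ 2), by positivity, max 0 (1 - 1 / (CM * CL) ^ 2), le_max_left _ _,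
      max_lt one_pos (by have : 0 < 1 / (CM * CL) ^ 2 := by positivity
                         linarith), le_trans (le_of_eq ?_) (le_max_right _ _)⟩
    field_simp
    ring
  have hc : ContractingWith (Real.sqrt q).toNNReal (fun w => w - t • A w) := by
    refine ⟨?_, LipschitzWith.of_dist_le_mul fun x y => ?_⟩
    · rw [Real.toNNReal_lt_one, Real.sqrt_lt' one_pos]
      simpa using hq1
    · rw [Real.coe_toNNReal _ (Real.sqrt_nonneg _), dist_eq_norm, dist_eq_norm]
      apply (sq_le_sq₀ (norm_nonneg _) (by positivity)).mp
      rw [mul_pow, Real.sq_sqrt hq0]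
      have e : x - t • A x - (y - t • A y) = (x - y) - t • (A x - A y) := by
        rw [smul_sub]; abel
      rw [e, norm_sub_sq_real, inner_smul_right, norm_smul, mul_pow, Real.norm_eq_abs, sq_abs]
      have h1 : ‖x - y‖ ^ 2 / CM ≤ inner ℝ (x - y) (A x - A y) := by
        rw [div_le_iff₀' hCM]; exact hMA x y
      have h2 : ‖A x - A y‖ ^ 2 ≤ CL ^ 2 * ‖x - y‖ ^ 2 := by
        rw [← mul_pow]; exact pow_le_pow_left₀ (norm_nonneg _) (hLA x y) 2
      have h3 := mul_le_mul_of_nonneg_left h1 ht.le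
      have h4 := mul_le_mul_of_nonneg_left h2 (sq_nonneg t)
      have h5 := mul_le_mul_of_nonneg_right hq (sq_nonneg ‖x - y‖)
      have e2 : (1 - 2 * t / CM + t ^ 2 * CL ^ 2) * ‖x - y‖ ^ 2 =
        ‖x - y‖ ^ 2 - 2 * (t * (‖x - y‖ ^ 2 / CM)) + t ^ 2 * (CL ^ 2 * ‖x - y‖ ^ 2) := by ring
      linarith
  have : CompleteSpace V := FiniteDimensional.complete ℝ V
  refine ⟨hc.fixedPoint _, fun v => ?_, fun y hy => ?_⟩
  · have h := hc.fixedPoint_isFixedPt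
    have h' : A (hc.fixedPoint _) = 0 := by
      have h2 := sub_eq_self.mp h
      exact (smul_eq_zero.mp h2).resolve_left ht.ne'
    rw [← hA, h', inner_zero_left]
  · apply hc.fixedPoint_unique
    have : A y = 0 := by
      rw [← inner_self_eq_zero (𝕜 := ℝ), hA, hy]
    simp [Function.IsFixedPt, this]
end

section
/- Let E be a real inner product space, V ⊆ E a nonzero finite-dimensional linear subspace, and let a : V×V → ℝ be linear in its second argument, Lipschitz continuous in its first argument (|a(w,v) − a(w',v)| ≤ C_L‖w−w'‖‖v‖ for all w, w', v ∈ V, for some C_L > 0), and strongly monotone (‖w−w'‖² ≤ C_M·( a(w, w−w') − a(w', w−w') ) for all w, w' ∈ V, for some C_M > 0). Let u ∈ E and suppose there is a constant C_c ≥ 0 such that a(v,z) ≤ C_c‖u−v‖‖z‖ for all v, z ∈ V. Then the unique u_V ∈ V satisfying a(u_V, v) = 0 for all v ∈ V obeys the near-best approximation bound ‖u − u_V‖ ≤ (1 + C_M·C_c) · inf_{v∈V} ‖u − v‖. -/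
/-- abstract near-best approximation (Céa-type) bound for a Lipschitz,
strongly monotone, consistent semilinear form on a finite-dimensional subspace. -/
theorem stmt15 {E : Type*} [NormedAddCommGroup E] [InnerProductSpace ℝ E]
    (V : Submodule ℝ E) [FiniteDimensional ℝ V] (hV : V ≠ ⊥)
    (a : V → V → ℝ) (hlin : ∀ w : V, IsLinearMap ℝ (a w))
    (CL : ℝ) (hCL : 0 < CL)
    (hLip : ∀ w w' v : V, |a w v - a w' v| ≤ CL * ‖w - w'‖ * ‖v‖)
    (CM : ℝ) (hCM : 0 < CM)
    (hMono : ∀ w w' : V, ‖w - w'‖ ^ 2 ≤ CM * (a w (w - w') - a w' (w - w')))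
    (u : E) (Cc : ℝ) (hCc : 0 ≤ Cc)
    (hcons : ∀ v z : V, a v z ≤ Cc * ‖u - (v : E)‖ * ‖z‖)
    (uV : V) (huV : ∀ v : V, a uV v = 0) :
    ‖u - (uV : E)‖ ≤ (1 + CM * Cc) * ⨅ v : V, ‖u - (v : E)‖ := by
  rw [Real.mul_iInf_of_nonneg (by positivity)]
  refine le_ciInf fun v => ?_
  have h1 := hMono v uV
  rw [huV, sub_zero] at h1
  have h2 := mul_le_mul_of_nonneg_left (hcons v (v - uV)) hCM.le
  have h3 : ‖v - uV‖ ≤ CM * Cc * ‖u - (v : E)‖ := by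
    rcases (norm_nonneg (v - uV)).eq_or_lt with h | h
    · rw [← h]; positivity
    · refine le_of_mul_le_mul_right ?_ h
      nlinarith
  have h4 : ‖u - (uV : E)‖ ≤ ‖u - (v : E)‖ + ‖(v : E) - uV‖ := norm_sub_le_norm_sub_add_norm_sub _ _ _
  have h5 : ‖(v : E) - uV‖ = ‖v - uV‖ := rfl
  linarith
end

section
/- The following integral identity holds: ∫_{[0,1]²} ( 2 + sin²(2πy₁)·cos²(2πy₂) )^{-1} dy₁ dy₂ = (√6/(3π)) · ∫_0^{π/2} ( 1 − (1/3)·sin²θ )^{-1/2} dθ. (This evaluates the cell average ∫_Y 1/(a₀ + a₁) appearing in the explicit effective Hamiltonian H(R) = −(∫_Y 1/(a₀+a₁))^{-1} B:R − 1 of the paper's numerical experiment, where a₀ ≡ 1 and a₁(y) = sin²(2πy₁)cos²(2πy₂) + 1, in terms of the complete elliptic integral of the first kind with parameter m = 1/3.) -/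
open MeasureTheory Real

lemma inner_aux (k : ℝ) (hk : 0 < k) (t : ℝ) :
    HasDerivAt (fun t : ℝ => t - arctan ((1 - k) * (sin t * cos t) / (cos t ^ 2 + k * sin t ^ 2)))
      (k / (cos t ^ 2 + k ^ 2 * sin t ^ 2)) t := by
  have hsc := sin_sq_add_cos_sq t
  have pos : ∀ j : ℝ, 0 < j → 0 < cos t ^ 2 + j * sin t ^ 2 := by
    intro j hj
    by_cases h : sin t = 0
    · rw [h] at hsc ⊢; nlinarith
    · have : 0 < sin t ^ 2 := by positivity
      positivity
  have hD := pos k hk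
  have hE := pos (k ^ 2) (by positivity)
  have h1 := ((hasDerivAt_sin t).mul (hasDerivAt_cos t)).const_mul (1 - k)
  have h2 := ((hasDerivAt_cos t).pow 2).add (((hasDerivAt_sin t).pow 2).const_mul k)
  have h3 := (hasDerivAt_id t).sub ((h1.div h2 hD.ne').arctan)
  refine h3.congr_deriv ?_
  simp only [Pi.mul_apply, Pi.add_apply, Pi.pow_apply, Pi.div_apply]
  generalize sin t = s at *
  generalize cos t = c at *
  have e : (c ^ 2 + k * s ^ 2) ^ 2 + ((1 - k) * (s * c)) ^ 2 = c ^ 2 + k ^ 2 * s ^ 2 := by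
    linear_combination (c ^ 2 + k ^ 2 * s ^ 2) * hsc
  have e2 : 1 + ((1 - k) * (s * c) / (c ^ 2 + k * s ^ 2)) ^ 2
      = (c ^ 2 + k ^ 2 * s ^ 2) / (c ^ 2 + k * s ^ 2) ^ 2 := by
    rw [← e]; field_simp
  rw [e2]
  have hE' := hE.ne'
  have hD' := hD.ne'
  field_simp
  push_cast
  have : c ^ 2 = 1 - s ^ 2 := by linarith
  ring_nf
  have c4 : c ^ 4 = (1 - s ^ 2) ^ 2 := by rw [← this]; ring
  simp only [c4, this]
  ring

lemma inner_int (b : ℝ) (hb : 0 ≤ b) :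
    ∫ t in (0 : ℝ)..(2 * π), (2 + b * cos t ^ 2)⁻¹ = 2 * π * (√(4 + 2 * b))⁻¹ := by
  have hr : 0 < √(4 + 2 * b) := by positivity
  have hr2 : √(4 + 2 * b) ^ 2 = 4 + 2 * b := sq_sqrt (by positivity)
  set r := √(4 + 2 * b)
  have hc : Continuous fun t : ℝ => (2 + b * cos t ^ 2)⁻¹ :=
    Continuous.inv₀ (by fun_prop) (fun t => by positivity)
  have hd : ∀ t : ℝ, HasDerivAt (fun t : ℝ => r⁻¹ * (t - arctan ((1 - 2 / r) * (sin t * cos t) /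
      (cos t ^ 2 + (2 / r) * sin t ^ 2)))) ((2 + b * cos t ^ 2)⁻¹) t := by
    intro t
    refine ((inner_aux (2 / r) (by positivity) t).const_mul r⁻¹).congr_deriv ?_
    have e : cos t ^ 2 + (2 / r) ^ 2 * sin t ^ 2 = 2 * (2 + b * cos t ^ 2) / r ^ 2 := by
      rw [div_pow, eq_div_iff (by positivity), add_mul, sin_sq]
      field_simp
      rw [hr2]; ring
    have : 2 + b * cos t ^ 2 ≠ 0 := by positivity
    rw [e]; field_simp
  rw [intervalIntegral.integral_eq_sub_of_hasDerivAt (fun t _ => hd t)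
    (hc.intervalIntegrable _ _)]
  simp
  ring

lemma outer_int :
    ∫ t in (0 : ℝ)..(2 * π), (√(4 + 2 * sin t ^ 2))⁻¹
      = 4 * ∫ t in (0 : ℝ)..(π / 2), (√(4 + 2 * cos t ^ 2))⁻¹ := by
  set G : ℝ → ℝ := fun t => (√(4 + 2 * sin t ^ 2))⁻¹ with hG
  have hc : Continuous G := Continuous.inv₀ (by fun_prop) (fun t => by positivity)
  have hi : ∀ a b, IntervalIntegrable G volume a b := fun a b => hc.intervalIntegrable _ _
  have s3 : ∀ u : ℝ, sin (3 * π / 2 - u) = - cos u := by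
    intro u
    rw [show 3 * π / 2 - u = π / 2 - u + π by ring, sin_add_pi, sin_pi_div_two_sub]
  have s4 : ∀ u : ℝ, sin (u + 3 * π / 2) = - cos u := by
    intro u
    rw [show u + 3 * π / 2 = u + π / 2 + π by ring, sin_add_pi, sin_add_pi_div_two]
  have i1 := intervalIntegral.integral_comp_sub_left G (π / 2) (a := 0) (b := π / 2)
  have i2 := intervalIntegral.integral_comp_add_right G (π / 2) (a := 0) (b := π / 2)
  have i3 := intervalIntegral.integral_comp_sub_left G (3 * π / 2) (a := 0) (b := π / 2)
  have i4 := intervalIntegral.integral_comp_add_right G (3 * π / 2) (a := 0) (b := π / 2)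
  rw [show π / 2 - π / 2 = 0 by ring, sub_zero] at i1
  rw [zero_add, show π / 2 + π / 2 = π by ring] at i2
  rw [show 3 * π / 2 - π / 2 = π by ring, sub_zero] at i3
  rw [zero_add, show π / 2 + 3 * π / 2 = 2 * π by ring] at i4
  simp only [hG, sin_pi_div_two_sub, sin_add_pi_div_two, s3, s4, neg_sq] at i1 i2 i3 i4
  rw [← intervalIntegral.integral_add_adjacent_intervals (hi 0 (3 * π / 2)) (hi _ _),
    ← intervalIntegral.integral_add_adjacent_intervals (hi 0 π) (hi _ _),
    ← intervalIntegral.integral_add_adjacent_intervals (hi 0 (π / 2)) (hi _ _)]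
  simp only [hG]
  rw [← i1, ← i2, ← i3, ← i4]
  ring

/-- the cell average `∫_Y (2 + sin²(2πy₁)cos²(2πy₂))⁻¹` expressed via the
complete elliptic integral of the first kind with parameter `m = 1/3`. -/
theorem stmt17 :
    (∫ y in (Set.Icc (0 : ℝ) 1 ×ˢ Set.Icc (0 : ℝ) 1),
        (2 + Real.sin (2 * π * y.1) ^ 2 * Real.cos (2 * π * y.2) ^ 2)⁻¹)
      = (Real.sqrt 6 / (3 * π))
        * ∫ θ in Set.Icc (0 : ℝ) (π / 2),
            (Real.sqrt (1 - (1 / 3) * Real.sin θ ^ 2))⁻¹ := by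
  have hpi := pi_pos
  have hc : Continuous fun y : ℝ × ℝ =>
      (2 + Real.sin (2 * π * y.1) ^ 2 * Real.cos (2 * π * y.2) ^ 2)⁻¹ :=
    Continuous.inv₀ (by fun_prop) (fun t => by positivity)
  rw [Measure.volume_eq_prod, setIntegral_prod _ (by
    rw [← Measure.volume_eq_prod]
    exact hc.continuousOn.integrableOn_compact (isCompact_Icc.prod isCompact_Icc))]
  have inn : ∀ x : ℝ, ∫ y in Set.Icc (0 : ℝ) 1,
      (2 + Real.sin (2 * π * x) ^ 2 * Real.cos (2 * π * y) ^ 2)⁻¹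
      = (√(4 + 2 * sin (2 * π * x) ^ 2))⁻¹ := by
    intro x
    rw [integral_Icc_eq_integral_Ioc, ← intervalIntegral.integral_of_le zero_le_one,
      intervalIntegral.integral_comp_mul_left
        (fun t => (2 + Real.sin (2 * π * x) ^ 2 * Real.cos t ^ 2)⁻¹) (by positivity : 2 * π ≠ 0),
      mul_zero, mul_one, inner_int _ (by positivity), smul_eq_mul, ← mul_assoc,
      inv_mul_cancel₀ (by positivity), one_mul]
  simp only [inn]
  rw [integral_Icc_eq_integral_Ioc, ← intervalIntegral.integral_of_le zero_le_one,
    intervalIntegral.integral_comp_mul_left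
      (fun t => (√(4 + 2 * sin t ^ 2))⁻¹) (by positivity : 2 * π ≠ 0),
    mul_zero, mul_one, outer_int, integral_Icc_eq_integral_Ioc,
    ← intervalIntegral.integral_of_le (by positivity)]
  have h6 : √6 ^ 2 = 6 := sq_sqrt (by norm_num)
  have e : ∀ t : ℝ, (√(4 + 2 * cos t ^ 2))⁻¹ = (√6)⁻¹ * (√(1 - (1 / 3) * sin t ^ 2))⁻¹ := by
    intro t
    rw [← mul_inv, ← sqrt_mul (by norm_num), cos_sq']
    congr 2; ring
  simp only [e, intervalIntegral.integral_const_mul, smul_eq_mul]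
  rw [← mul_assoc, ← mul_assoc]
  congr 1
  field_simp
  rw [h6]; norm_num
end
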